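/- Let X and Y be independent random variables on a probability space (Ω, 𝓕, ℙ), where X has the centered Gaussian distribution with standard deviation σ > 0 and Y has the Pareto distribution with shape a > 0 and scale θ > 0. Then the product Z = X·Y has probability density function f_Z(z) = ( a·θ^a·σ^a / (√(2π)·|z|^{a+1}) ) · 2^{(a-1)/2} · γ( (a+1)/2 , z²/(2σ²θ²) ) for every z ≠ 0, where γ(s,x) = ∫₀ˣ t^{s-1}·e^{-t} dt is the lower incomplete gamma function. -/

import Mathlib

open MeasureTheory ProbabilityTheory Real

/-- The Pareto probability density function with shape `a` and scale `θ`. -/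
noncomputable def paretoPdf (a θ x : ℝ) : ℝ :=
  if θ < x then a * θ ^ a * x ^ (-(a + 1)) else 0

/-- The centered Gaussian probability density function with standard deviation `σ`. -/
noncomputable def gaussPdf (σ x : ℝ) : ℝ :=
  (1 / (Real.sqrt (2 * π) * σ)) * Real.exp (-x ^ 2 / (2 * σ ^ 2))

/-- The lower incomplete gamma function `γ(s, x) = ∫₀ˣ t^(s-1) e^(-t) dt`. -/
noncomputable def lowerIncGamma (s x : ℝ) : ℝ :=
  ∫ t in (0:ℝ)..x, t ^ (s - 1) * Real.exp (-t)

lemma measurable_gaussPdf (σ : ℝ) : Measurable (gaussPdf σ) := by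
  unfold gaussPdf
  fun_prop

lemma measurable_paretoPdf (a θ : ℝ) : Measurable (paretoPdf a θ) := by
  unfold paretoPdf
  exact Measurable.ite measurableSet_Ioi (by fun_prop) measurable_const

lemma ofReal_lowerIncGamma {s x : ℝ} (hs : 0 < s) (hx : 0 ≤ x) :
    ENNReal.ofReal (lowerIncGamma s x)
      = ∫⁻ t in Set.Ioo 0 x, ENNReal.ofReal (t ^ (s - 1) * Real.exp (-t)) := by
  have hint : IntervalIntegrable (fun t : ℝ => t ^ (s - 1) * Real.exp (-t)) volume 0 x :=
    (intervalIntegral.intervalIntegrable_rpow' (by linarith)).mul_continuousOn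
      (by fun_prop)
  rw [lowerIncGamma, intervalIntegral.integral_of_le hx, integral_Ioc_eq_integral_Ioo,
    ofReal_integral_eq_lintegral_ofReal]
  · exact ((intervalIntegrable_iff_integrableOn_Ioc_of_le hx).1 hint).mono_set
      Set.Ioo_subset_Ioc_self
  · filter_upwards [ae_restrict_mem measurableSet_Ioo] with t ht
    have := ht.1
    positivity

lemma image_const_div_sq_Ioi {K θ : ℝ} (hK : 0 < K) (hθ : 0 < θ) :
    (fun y : ℝ => K / y ^ 2) '' Set.Ioi θ = Set.Ioo 0 (K / θ ^ 2) := by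
  ext t
  simp only [Set.mem_image, Set.mem_Ioi, Set.mem_Ioo]
  constructor
  · rintro ⟨y, hy, rfl⟩
    have : 0 < y := hθ.trans hy
    exact ⟨by positivity, by gcongr⟩
  · rintro ⟨ht, ht'⟩
    refine ⟨√(K / t), ?_, ?_⟩
    · rw [lt_div_iff₀ (by positivity)] at ht'
      apply Real.lt_sqrt_of_sq_lt
      rw [lt_div_iff₀ ht]
      linarith
    · rw [Real.sq_sqrt (by positivity)]
      field_simp

/-- Substitution `t = K / y ^ 2` in a Lebesgue integral. -/
lemma lintegral_Ioo_eq_lintegral_Ioi_const_div_sq {K θ : ℝ} (hK : 0 < K) (hθ : 0 < θ)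
    (g : ℝ → ENNReal) :
    ∫⁻ t in Set.Ioo 0 (K / θ ^ 2), g t
      = ∫⁻ y in Set.Ioi θ, ENNReal.ofReal (2 * K / y ^ 3) * g (K / y ^ 2) := by
  rw [← image_const_div_sq_Ioi hK hθ,
    lintegral_image_eq_lintegral_abs_deriv_mul (f' := fun y => -(2 * K / y ^ 3))
      measurableSet_Ioi]
  · refine setLIntegral_congr_fun measurableSet_Ioi fun y hy => ?_
    have : 0 < y := hθ.trans hy
    simp only [abs_neg]
    rw [abs_of_pos (by positivity)]
  · intro y hy
    have hy0 : y ≠ 0 := (hθ.trans hy).ne'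
    have h := (hasDerivAt_const y K).div (hasDerivAt_pow 2 y) (pow_ne_zero 2 hy0)
    refine (h.congr_deriv ?_).hasDerivWithinAt
    field_simp
    push_cast
    ring
  · intro y hy w hw h
    have hy0 : 0 < y := hθ.trans hy
    have hw0 : 0 < w := hθ.trans hw
    simp only at h
    rw [div_eq_div_iff (by positivity) (by positivity)] at h
    exact ((pow_left_inj₀ hw0.le hy0.le two_ne_zero).1 (mul_left_cancel₀ hK.ne' h)).symm

lemma paretoPdf_mul_gaussPdf_div {a θ σ y z : ℝ} (hθ : 0 < θ) (hσ : 0 < σ)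
    (hz : z ≠ 0) (hy : θ < y) :
    paretoPdf a θ y * (1 / y) * gaussPdf σ (z / y)
      = a * θ ^ a * σ ^ a / (√(2 * π) * |z| ^ (a + 1)) * (2 : ℝ) ^ ((a - 1) / 2)
        * (2 * (z ^ 2 / (2 * σ ^ 2)) / y ^ 3
          * ((z ^ 2 / (2 * σ ^ 2) / y ^ 2) ^ ((a + 1) / 2 - 1)
            * Real.exp (-(z ^ 2 / (2 * σ ^ 2) / y ^ 2)))) := by
  have hy0 : 0 < y := hθ.trans hy
  have hz0 : 0 < |z| := abs_pos.2 hz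
  have hbase : z ^ 2 / (2 * σ ^ 2) / y ^ 2 = (|z| / (σ * y)) ^ (2 : ℝ) / 2 := by
    rw [Real.rpow_two, div_pow, sq_abs]
    field_simp
  have hpow : (z ^ 2 / (2 * σ ^ 2) / y ^ 2) ^ ((a + 1) / 2 - 1)
      = |z| ^ a / |z| / (σ ^ a / σ * (y ^ a / y)) / (2 : ℝ) ^ ((a - 1) / 2) := by
    rw [hbase, show (a + 1) / 2 - 1 = (a - 1) / 2 by ring,
      Real.div_rpow (by positivity) (by positivity), ← Real.rpow_mul (by positivity),
      show 2 * ((a - 1) / 2) = a - 1 by ring, Real.div_rpow hz0.le (by positivity),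
      Real.mul_rpow hσ.le hy0.le, Real.rpow_sub_one hz0.ne', Real.rpow_sub_one hσ.ne',
      Real.rpow_sub_one hy0.ne']
  have hexp : -(z / y) ^ 2 / (2 * σ ^ 2) = -(z ^ 2 / (2 * σ ^ 2) / y ^ 2) := by
    field_simp
  rw [paretoPdf, if_pos hy, gaussPdf, hexp, hpow, Real.rpow_neg hy0.le,
    Real.rpow_add_one hy0.ne', Real.rpow_add_one hz0.ne', ← sq_abs z]
  field_simp

/-- Evaluation of the Mellin-type convolution of a Pareto and a centered Gaussian density. -/
lemma lintegral_paretoPdf_mul_gaussPdf_div {a θ σ z : ℝ} (ha : 0 < a) (hθ : 0 < θ)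
    (hσ : 0 < σ) (hz : z ≠ 0) :
    ∫⁻ y in Set.Ioi θ, ENNReal.ofReal (paretoPdf a θ y * (1 / y) * gaussPdf σ (z / y))
      = ENNReal.ofReal (a * θ ^ a * σ ^ a / (√(2 * π) * |z| ^ (a + 1))
          * (2 : ℝ) ^ ((a - 1) / 2)
          * lowerIncGamma ((a + 1) / 2) (z ^ 2 / (2 * σ ^ 2 * θ ^ 2))) := by
  have hK : 0 < z ^ 2 / (2 * σ ^ 2) := by positivity
  have hz0 : 0 < |z| := abs_pos.2 hz
  rw [ENNReal.ofReal_mul (by positivity), ofReal_lowerIncGamma (by positivity) (by positivity),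
    ← div_div (z ^ 2), lintegral_Ioo_eq_lintegral_Ioi_const_div_sq hK hθ,
    ← lintegral_const_mul' _ _ ENNReal.ofReal_ne_top]
  refine setLIntegral_congr_fun measurableSet_Ioi fun y hy => ?_
  have hy0 : 0 < y := hθ.trans hy
  rw [paretoPdf_mul_gaussPdf_div hθ hσ hz hy, ← ENNReal.ofReal_mul (by positivity),
    ← ENNReal.ofReal_mul (by positivity)]

/-- Scaling of the variable in a Lebesgue integral over the real line. -/
lemma lintegral_comp_mul_right_of_pos {y : ℝ} (hy : 0 < y) (g : ℝ → ENNReal)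
    (hg : Measurable g) :
    ∫⁻ x, g (x * y) = ENNReal.ofReal (1 / y) * ∫⁻ z, g z := by
  rw [← lintegral_map hg (measurable_mul_const y), Real.map_volume_mul_right hy.ne',
    lintegral_smul_measure, abs_of_pos (inv_pos.2 hy), one_div, smul_eq_mul]

theorem product_of_gaussian_pareto_pdf
    {Ω : Type*} [MeasurableSpace Ω] (P : Measure Ω) [IsProbabilityMeasure P]
    (X Y : Ω → ℝ) (hXm : Measurable X) (hYm : Measurable Y)
    (hindep : IndepFun X Y P)
    (a θ σ : ℝ) (ha : 0 < a) (hθ : 0 < θ) (hσ : 0 < σ)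
    (hX : Measure.map X P
      = (volume : Measure ℝ).withDensity (fun x => ENNReal.ofReal (gaussPdf σ x)))
    (hY : Measure.map Y P
      = (volume : Measure ℝ).withDensity (fun y => ENNReal.ofReal (paretoPdf a θ y))) :
    Measure.map (fun ω => X ω * Y ω) P
      = (volume : Measure ℝ).withDensity (fun z => ENNReal.ofReal
          (a * θ ^ a * σ ^ a / (Real.sqrt (2 * π) * |z| ^ (a + 1))
            * (2:ℝ) ^ ((a - 1) / 2)
            * lowerIncGamma ((a + 1) / 2) (z ^ 2 / (2 * σ ^ 2 * θ ^ 2)))) := by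
  have hgm := measurable_gaussPdf σ
  have hpm := measurable_paretoPdf a θ
  ext s hs
  have hind : Measurable (s.indicator (1 : ℝ → ENNReal)) := measurable_one.indicator hs
  have hpair := (indepFun_iff_map_prod_eq_prod_map_map hXm.aemeasurable hYm.aemeasurable).1 hindep
  have := Measure.isProbabilityMeasure_map (μ := P) hXm.aemeasurable
  have := Measure.isProbabilityMeasure_map (μ := P) hYm.aemeasurable
  calc Measure.map (fun ω => X ω * Y ω) P s
      = ∫⁻ p, s.indicator 1 (p.1 * p.2) ∂((P.map X).prod (P.map Y)) := by
        rw [← hpair, lintegral_map (by fun_prop) (by fun_prop),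
          ← lintegral_indicator_one hs, lintegral_map hind (by fun_prop)]
    _ = ∫⁻ y, ∫⁻ x, s.indicator 1 (x * y) ∂(P.map X) ∂(P.map Y) :=
        lintegral_prod_symm' _ (by fun_prop)
    _ = ∫⁻ y, ENNReal.ofReal (paretoPdf a θ y)
          * ∫⁻ x, ENNReal.ofReal (gaussPdf σ x) * s.indicator 1 (x * y) := by
        have hinner : Measurable fun y => ∫⁻ x, s.indicator 1 (x * y) ∂(P.map X) :=
          Measurable.lintegral_prod_left' (f := fun p : ℝ × ℝ => s.indicator 1 (p.1 * p.2))
            (by fun_prop)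
        rw [hY, lintegral_withDensity_eq_lintegral_mul _ (by fun_prop) hinner]
        refine lintegral_congr fun y => ?_
        rw [Pi.mul_apply, hX,
          lintegral_withDensity_eq_lintegral_mul _ (by fun_prop) (by fun_prop)]
        rfl
    _ = ∫⁻ y in Set.Ioi θ, ENNReal.ofReal (paretoPdf a θ y)
          * ∫⁻ x, ENNReal.ofReal (gaussPdf σ x) * s.indicator 1 (x * y) := by
        rw [← lintegral_indicator measurableSet_Ioi]
        refine lintegral_congr fun y => ?_
        by_cases hy : θ < y
        · rw [Set.indicator_of_mem (Set.mem_Ioi.2 hy)]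
        · rw [Set.indicator_of_notMem (by simpa using hy), paretoPdf, if_neg hy]
          simp
    _ = ∫⁻ y in Set.Ioi θ, ∫⁻ z,
          ENNReal.ofReal (paretoPdf a θ y * (1 / y) * gaussPdf σ (z / y))
            * s.indicator 1 z := by
        refine setLIntegral_congr_fun measurableSet_Ioi fun y hy => ?_
        have hy0 : 0 < y := hθ.trans hy
        have hpos : 0 ≤ paretoPdf a θ y := by
          rw [paretoPdf, if_pos (Set.mem_Ioi.1 hy)]
          positivity
        have hscale := lintegral_comp_mul_right_of_pos hy0
          (fun z => ENNReal.ofReal (gaussPdf σ (z / y)) * s.indicator 1 z) (by fun_prop)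
        simp only [mul_div_cancel_right₀ _ hy0.ne'] at hscale
        rw [hscale, ← mul_assoc, ← ENNReal.ofReal_mul hpos,
          ← lintegral_const_mul' _ _ ENNReal.ofReal_ne_top]
        refine lintegral_congr fun z => ?_
        rw [← mul_assoc, ← ENNReal.ofReal_mul (by positivity)]
    _ = ∫⁻ z, ∫⁻ y in Set.Ioi θ,
          ENNReal.ofReal (paretoPdf a θ y * (1 / y) * gaussPdf σ (z / y))
            * s.indicator 1 z :=
        lintegral_lintegral_swap (by unfold Function.uncurry; fun_prop)
    _ = ∫⁻ z, s.indicator (fun z => ENNReal.ofReal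
          (a * θ ^ a * σ ^ a / (Real.sqrt (2 * π) * |z| ^ (a + 1))
            * (2:ℝ) ^ ((a - 1) / 2)
            * lowerIncGamma ((a + 1) / 2) (z ^ 2 / (2 * σ ^ 2 * θ ^ 2)))) z := by
        refine lintegral_congr_ae ?_
        filter_upwards [Measure.ae_ne volume (0 : ℝ)] with z hz
        rw [lintegral_mul_const _ (by fun_prop),
          lintegral_paretoPdf_mul_gaussPdf_div ha hθ hσ hz]
        by_cases hzs : z ∈ s <;> simp [hzs]
    _ = _ := by rw [lintegral_indicator hs, withDensity_apply _ hs]
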